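/- For every integer k ≥ 1 there exists a positive polynomial p_k : ℝ → ℝ such that, on the event E := {‖A−K‖_op ≤ λ(K)/2}, one has |h_k(A,t,x)| ≤ p_k(‖x‖)·‖A−K‖_HS^k for all t ∈ [0,1] and x ∈ ℝ^d. -/

import Mathlib

open MeasureTheory ProbabilityTheory Matrix

noncomputable section

/-- Euclidean norm on `Fin d → ℝ`. -/
def euclNorm {d : ℕ} (x : Fin d → ℝ) : ℝ := Real.sqrt (∑ i, x i ^ 2)

/-- Hilbert–Schmidt norm of a matrix. -/
def hsNorm {d : ℕ} (M : Matrix (Fin d) (Fin d) ℝ) : ℝ := Real.sqrt (∑ i, ∑ j, M i j ^ 2)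

/-- Operator norm of a matrix (w.r.t. the Euclidean norm). -/
def opNorm {d : ℕ} (M : Matrix (Fin d) (Fin d) ℝ) : ℝ :=
  sSup {r : ℝ | ∃ x : Fin d → ℝ, euclNorm x = 1 ∧ r = euclNorm (M.mulVec x)}

/-- Smallest eigenvalue of a symmetric matrix (as the infimum of the Rayleigh quotient). -/
def lambdaMin {d : ℕ} (M : Matrix (Fin d) (Fin d) ℝ) : ℝ :=
  sInf {r : ℝ | ∃ x : Fin d → ℝ, euclNorm x = 1 ∧ r = x ⬝ᵥ M.mulVec x}

/-- Density of the centered Gaussian law `N_d(0, M)` on `ℝ^d`. -/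
def gaussDensity {d : ℕ} (M : Matrix (Fin d) (Fin d) ℝ) (x : Fin d → ℝ) : ℝ :=
  (Real.sqrt ((2 * Real.pi) ^ d * M.det))⁻¹ * Real.exp (-(1/2) * (x ⬝ᵥ M⁻¹.mulVec x))

/-- The centered Gaussian law `N_d(0, M)` on `ℝ^d` (for `M` positive definite). -/
def gaussLaw {d : ℕ} (M : Matrix (Fin d) (Fin d) ℝ) : Measure (Fin d → ℝ) :=
  volume.withDensity fun x => ENNReal.ofReal (gaussDensity M x)

/-- Relative entropy (Kullback–Leibler divergence) of `μ` with respect to `ν`. -/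
def relEnt {E : Type*} [MeasurableSpace E] (μ ν : Measure E) : ℝ :=
  ∫ x, Real.log ((μ.rnDeriv ν x).toReal) ∂μ

/-- `F` is a centered, integrable random vector which is conditionally Gaussian with respect to
the σ-field `𝓕`, with conditional covariance matrix `A`. -/
def CondGaussian {Ω : Type*} [MeasurableSpace Ω] (P : Measure Ω) {d : ℕ}
    (F : Ω → Fin d → ℝ) (𝓕 : MeasurableSpace Ω)
    (A : Ω → Matrix (Fin d) (Fin d) ℝ) : Prop :=
  Integrable F P ∧ (∫ ω, F ω ∂P) = 0 ∧
  (∀ ω, (A ω).PosSemidef) ∧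
  Measurable[𝓕] (fun ω i j => A ω i j) ∧
  ∀ y : Fin d → ℝ,
    P[(fun ω => Complex.exp (Complex.I * ((y ⬝ᵥ F ω : ℝ) : ℂ))) | 𝓕] =ᵐ[P]
      fun ω => ((Real.exp (-(1/2) * (y ⬝ᵥ (A ω).mulVec y)) : ℝ) : ℂ)

/-- The dimensional constant `2√6 + 3√2 + 2 + √d`. -/
def Cfac (d : ℕ) : ℝ := 2 * Real.sqrt 6 + 3 * Real.sqrt 2 + 2 + Real.sqrt d

/-- `max{ |log(2^d det K/(2‖K‖_op + λ(K))^d)| , log(2^d det K/λ(K)^d) }`. -/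
def maxLog {d : ℕ} (K : Matrix (Fin d) (Fin d) ℝ) : ℝ :=
  max |Real.log ((2 ^ d * K.det) / ((2 * opNorm K + lambdaMin K) ^ d))|
      (Real.log ((2 ^ d * K.det) / (lambdaMin K ^ d)))


/-- The event `E = {‖A − K‖_op ≤ λ(K)/2}`. -/
def EvSet {Ω : Type*} {d : ℕ} (A : Ω → Matrix (Fin d) (Fin d) ℝ)
    (K : Matrix (Fin d) (Fin d) ℝ) : Set Ω :=
  {ω | opNorm (A ω - K) ≤ lambdaMin K / 2}


/-- The interpolating matrix `Γ_t = tA + (1−t)K`. -/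
def Gam {d : ℕ} (A K : Matrix (Fin d) (Fin d) ℝ) (t : ℝ) : Matrix (Fin d) (Fin d) ℝ :=
  t • A + (1 - t) • K

/-- The interpolating density ratio `g(A,t,x) = φ_{Γ_t}(x)/φ_K(x)`. -/
def gfun {d : ℕ} (A K : Matrix (Fin d) (Fin d) ℝ) (t : ℝ) (x : Fin d → ℝ) : ℝ :=
  gaussDensity (Gam A K t) x / gaussDensity K x

/-- `h_k(A,t,x) = (∂^k g/∂t^k)(A,t,x) / g(A,t,x)`. -/
def hfun {d : ℕ} (k : ℕ) (A K : Matrix (Fin d) (Fin d) ℝ) (t : ℝ) (x : Fin d → ℝ) : ℝ :=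
  iteratedDeriv k (fun s => gfun A K s x) t / gfun A K t x

/-- `g̃(A,t,x) = E[φ_{Γ_t}(x) 1_E] / (P(E) φ_K(x))`. -/
def gtilde {Ω : Type*} [MeasurableSpace Ω] (P : Measure Ω) {d : ℕ}
    (A : Ω → Matrix (Fin d) (Fin d) ℝ) (K : Matrix (Fin d) (Fin d) ℝ)
    (t : ℝ) (x : Fin d → ℝ) : ℝ :=
  (∫ ω in EvSet A K, gaussDensity (Gam (A ω) K t) x ∂P) /
    ((P (EvSet A K)).toReal * gaussDensity K x)

end

section Helpers

theorem aux_spec {d : ℕ} (B : Matrix (Fin d) (Fin d) ℝ) (hB : B.IsHermitian) :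
    ∃ (U : Matrix (Fin d) (Fin d) ℝ) (s : Fin d → ℝ), Uᵀ * U = 1 ∧ Uᵀ * B * U = diagonal s := by
  have hU : star (hB.eigenvectorUnitary : Matrix (Fin d) (Fin d) ℝ) *
      (hB.eigenvectorUnitary : Matrix (Fin d) (Fin d) ℝ) = 1 :=
    Unitary.coe_star_mul_self hB.eigenvectorUnitary
  have hs := hB.spectral_theorem
  rw [Unitary.conjStarAlgAut_apply] at hs
  have e : ∀ M : Matrix (Fin d) (Fin d) ℝ, star M = Mᵀ := fun M => by
    rw [star_eq_conjTranspose, conjTranspose_eq_transpose_of_trivial]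
  refine ⟨hB.eigenvectorUnitary, hB.eigenvalues, ?_, ?_⟩
  · rw [← e]; exact hU
  · rw [← e]
    generalize (hB.eigenvectorUnitary : Matrix (Fin d) (Fin d) ℝ) = U at *
    conv_lhs => rw [hs]
    calc star U * (U * diagonal (RCLike.ofReal ∘ hB.eigenvalues) * star U) * U
        = (star U * U) * diagonal (RCLike.ofReal ∘ hB.eigenvalues) * (star U * U) := by
          simp only [Matrix.mul_assoc]
      _ = _ := by rw [hU]; simp

theorem aux_diag {d : ℕ} (K B : Matrix (Fin d) (Fin d) ℝ) (hK : K.PosDef) (hB : B.IsHermitian) :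
    ∃ (P : Matrix (Fin d) (Fin d) ℝ) (s : Fin d → ℝ), Pᵀ * K * P = 1 ∧
      Pᵀ * B * P = diagonal s := by
  obtain ⟨U, κ, hU, hκ⟩ := aux_spec K hK.1
  have hpos : ∀ i, 0 < κ i := by
    intro i
    have hUi : Function.Injective (U.mulVec) := by
      intro a b hab
      have := congrArg (Uᵀ.mulVec) hab
      simpa [hU] using this
    have hne : U *ᵥ (Pi.single i 1) ≠ 0 := by
      intro h
      have := hUi (h.trans (mulVec_zero U).symm)
      have := congrFun this i
      simp at this
    have h1 := hK.dotProduct_mulVec_pos hne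
    have h2 : (U *ᵥ (Pi.single i 1)) ⬝ᵥ (K *ᵥ (U *ᵥ (Pi.single i 1))) =
        (Pi.single i (1:ℝ)) ⬝ᵥ ((Uᵀ * K * U) *ᵥ (Pi.single i 1)) := by
      rw [Matrix.mul_assoc, ← mulVec_mulVec, ← mulVec_mulVec, dotProduct_mulVec (Pi.single i 1),
        vecMul_transpose]
    rw [star_trivial, h2, hκ] at h1
    simpa using h1
  set R := U * diagonal (fun i => (Real.sqrt (κ i))⁻¹) with hR
  have hRK : Rᵀ * K * R = 1 := by
    have : Rᵀ * K * R = diagonal (fun i => (Real.sqrt (κ i))⁻¹) * (Uᵀ * K * U) *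
        diagonal (fun i => (Real.sqrt (κ i))⁻¹) := by
      rw [hR]; simp only [transpose_mul, diagonal_transpose, Matrix.mul_assoc]
    rw [this, hκ, diagonal_mul_diagonal, diagonal_mul_diagonal, ← diagonal_one]
    congr 1
    ext i
    have h := Real.sqrt_pos.2 (hpos i)
    have h2 := Real.mul_self_sqrt (hpos i).le
    field_simp
    rw [pow_two]; exact h2.symm
  have hH : (Rᵀ * B * R).IsHermitian := by
    have := isHermitian_conjTranspose_mul_mul R hB
    rwa [conjTranspose_eq_transpose_of_trivial] at this
  obtain ⟨V, s, hV, hs⟩ := aux_spec _ hH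
  refine ⟨R * V, s, ?_, ?_⟩
  · calc (R * V)ᵀ * K * (R * V) = Vᵀ * (Rᵀ * K * R) * V := by
          simp only [transpose_mul, Matrix.mul_assoc]
      _ = 1 := by rw [hRK]; simpa using hV
  · rw [← hs]; simp only [transpose_mul, Matrix.mul_assoc]

theorem euclNorm_nonneg' {d : ℕ} (x : Fin d → ℝ) : 0 ≤ euclNorm x := Real.sqrt_nonneg _

theorem euclNorm_sq' {d : ℕ} (x : Fin d → ℝ) : euclNorm x ^ 2 = x ⬝ᵥ x := by
  rw [euclNorm, Real.sq_sqrt (Finset.sum_nonneg fun i _ => sq_nonneg _)]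
  simp [dotProduct, pow_two]

theorem abs_dot_le {d : ℕ} (x y : Fin d → ℝ) : |x ⬝ᵥ y| ≤ euclNorm x * euclNorm y := by
  refine abs_le_of_sq_le_sq ?_ (mul_nonneg (euclNorm_nonneg' _) (euclNorm_nonneg' _))
  have := Finset.sum_mul_sq_le_sq_mul_sq Finset.univ x y
  rw [mul_pow, euclNorm, euclNorm, Real.sq_sqrt (Finset.sum_nonneg fun i _ => sq_nonneg _),
    Real.sq_sqrt (Finset.sum_nonneg fun i _ => sq_nonneg _)]
  exact this

theorem mulVec_le {d : ℕ} (M : Matrix (Fin d) (Fin d) ℝ) (x : Fin d → ℝ) :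
    euclNorm (M *ᵥ x) ≤ hsNorm M * euclNorm x := by
  have h0 : 0 ≤ ∑ i, ∑ j, M i j ^ 2 :=
    Finset.sum_nonneg fun i _ => Finset.sum_nonneg fun j _ => sq_nonneg _
  rw [euclNorm, euclNorm, hsNorm, ← Real.sqrt_mul h0]
  apply Real.sqrt_le_sqrt
  rw [Finset.sum_mul]
  exact Finset.sum_le_sum fun i _ => Finset.sum_mul_sq_le_sq_mul_sq Finset.univ (M i) x

theorem euclNorm_smul' {d : ℕ} (c : ℝ) (x : Fin d → ℝ) : euclNorm (c • x) = |c| * euclNorm x := by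
  rw [euclNorm, euclNorm, ← Real.sqrt_sq_eq_abs, ← Real.sqrt_mul (sq_nonneg _), Finset.mul_sum]
  simp [mul_pow]

theorem euclNorm_pos' {d : ℕ} {x : Fin d → ℝ} (h : x ≠ 0) : 0 < euclNorm x := by
  have h1 := euclNorm_sq' x
  have h2 : x ⬝ᵥ x ≠ 0 := fun h' => h (dotProduct_self_eq_zero.1 h')
  have h3 := euclNorm_nonneg' x
  rcases h3.eq_or_lt with h4 | h4
  · rw [← h4] at h1; exact absurd h1.symm (by simpa using h2)
  · exact h4

theorem unit' {d : ℕ} {x : Fin d → ℝ} (h : x ≠ 0) :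
    euclNorm ((euclNorm x)⁻¹ • x) = 1 := by
  have := euclNorm_pos' h
  rw [euclNorm_smul', abs_of_pos (inv_pos.2 this), inv_mul_cancel₀ this.ne']

theorem mulVec_le_op {d : ℕ} (M : Matrix (Fin d) (Fin d) ℝ) {x : Fin d → ℝ} (h : x ≠ 0) :
    euclNorm (M *ᵥ x) ≤ opNorm M * euclNorm x := by
  have hp := euclNorm_pos' h
  have : euclNorm (M *ᵥ ((euclNorm x)⁻¹ • x)) ≤ opNorm M := by
    apply le_csSup
    · refine ⟨hsNorm M, ?_⟩
      rintro r ⟨y, hy, rfl⟩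
      have := mulVec_le M y
      rwa [hy, mul_one] at this
    · exact ⟨_, unit' h, rfl⟩
  rw [mulVec_smul, euclNorm_smul', abs_of_pos (inv_pos.2 hp), inv_mul_le_iff₀ hp] at this
  linarith

theorem lambda_le {d : ℕ} (K : Matrix (Fin d) (Fin d) ℝ) (hK : K.PosDef) {x : Fin d → ℝ}
    (h : x ≠ 0) : lambdaMin K * euclNorm x ^ 2 ≤ x ⬝ᵥ (K *ᵥ x) := by
  have hp := euclNorm_pos' h
  have : lambdaMin K ≤ ((euclNorm x)⁻¹ • x) ⬝ᵥ (K *ᵥ ((euclNorm x)⁻¹ • x)) := by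
    apply csInf_le
    · refine ⟨0, ?_⟩
      rintro r ⟨y, hy, rfl⟩
      simpa using hK.posSemidef.dotProduct_mulVec_nonneg y
    · exact ⟨_, unit' h, rfl⟩
  rw [mulVec_smul, smul_dotProduct, dotProduct_smul, smul_eq_mul, smul_eq_mul] at this
  calc _ ≤ _ := mul_le_mul_of_nonneg_right this (sq_nonneg _)
    _ = _ := by field_simp

theorem lambda_pos {d : ℕ} (hd : 1 ≤ d) (K : Matrix (Fin d) (Fin d) ℝ) (hK : K.PosDef) :
    0 < lambdaMin K := by
  obtain ⟨P, s, hP, -⟩ := aux_diag K 0 hK isHermitian_zero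
  have hinv : P * (Pᵀ * K) = 1 := mul_eq_one_comm.1 hP
  have hc : 0 < (hsNorm P ^ 2 + 1)⁻¹ := by positivity
  refine lt_of_lt_of_le hc (le_csInf ?_ ?_)
  · have : (Pi.single (⟨0, hd⟩ : Fin d) (1:ℝ) : Fin d → ℝ) ≠ 0 := by simp
    exact ⟨_, _, unit' this, rfl⟩
  · rintro r ⟨x, hx, rfl⟩
    set y := (Pᵀ * K) *ᵥ x with hy
    have hxy : P *ᵥ y = x := by rw [hy, mulVec_mulVec, hinv, one_mulVec]
    have h1 : x ⬝ᵥ (K *ᵥ x) = euclNorm y ^ 2 := by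
      rw [euclNorm_sq']
      conv_lhs => rw [← hxy]
      have : K *ᵥ (P *ᵥ y) = K *ᵥ x := by rw [hxy]
      rw [this, hy, ← mulVec_mulVec, dotProduct_mulVec (_ ) Pᵀ, vecMul_transpose]
    have h2 := mulVec_le P y
    rw [hxy, hx] at h2
    rw [h1, inv_le_iff_one_le_mul₀ (by positivity)]
    have h3 : 1 ≤ (hsNorm P * euclNorm y) ^ 2 := by nlinarith
    nlinarith [sq_nonneg (euclNorm y)]

/-- iterated derivatives from a tower -/
theorem tower {U : Set ℝ} (hU : IsOpen U) (F : ℕ → ℝ → ℝ)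
    (h : ∀ n, ∀ t ∈ U, HasDerivAt (F n) (F (n+1) t) t) (n : ℕ) :
    ∀ t ∈ U, iteratedDeriv n (F 0) t = F n t := by
  induction n with
  | zero => intro t _; simp
  | succ n ih =>
    intro t ht
    rw [iteratedDeriv_succ]
    have : iteratedDeriv n (F 0) =ᶠ[nhds t] F n :=
      Filter.eventually_of_mem (hU.mem_nhds ht) ih
    rw [this.deriv_eq, (h n t ht).deriv]

theorem tower_exp {U : Set ℝ} (hU : IsOpen U) (F : ℕ → ℝ → ℝ)
    (h : ∀ n, ∀ t ∈ U, HasDerivAt (F n) (F (n+1) t) t) (k : ℕ) (t : ℝ) (ht : t ∈ U) (D : ℝ)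
    (hD : ∀ i, 1 ≤ i → i ≤ k → |F i t| ≤ D ^ i) :
    |iteratedDeriv k (fun u => Real.exp (F 0 u)) t| ≤ k.factorial * Real.exp (F 0 t) * D ^ k := by
  have hcd : ∀ m : ℕ, ∀ n, ContDiffOn ℝ m (F n) U := by
    intro m
    induction m with
    | zero =>
      intro n
      rw [Nat.cast_zero, contDiffOn_zero]
      exact fun u hu => (h n u hu).continuousAt.continuousWithinAt
    | succ m ih =>
      intro n
      rw [Nat.cast_succ, contDiffOn_succ_iff_deriv_of_isOpen hU]
      refine ⟨fun u hu => (h n u hu).differentiableAt.differentiableWithinAt, by simp, ?_⟩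
      exact (ih (n+1)).congr fun u hu => (h n u hu).deriv
  have key := norm_iteratedFDerivWithin_comp_le (𝕜 := ℝ) (g := Real.exp) (f := F 0) (n := k)
    (s := U) (t := Set.univ) (x := t) (N := (k : ℕ)) (C := Real.exp (F 0 t)) (D := D)
    Real.contDiff_exp.contDiffOn (hcd k 0) le_rfl uniqueDiffOn_univ hU.uniqueDiffOn
    (Set.mapsTo_univ _ _) ht ?_ ?_
  · rw [norm_iteratedFDerivWithin_eq_norm_iteratedDerivWithin,
      iteratedDerivWithin_of_isOpen hU ht] at key
    exact key
  · intro i _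
    rw [norm_iteratedFDerivWithin_eq_norm_iteratedDerivWithin, iteratedDerivWithin_univ,
      iteratedDeriv_eq_iterate, Real.iter_deriv_exp, Real.norm_eq_abs, Real.abs_exp]
  · intro i h1 h2
    rw [norm_iteratedFDerivWithin_eq_norm_iteratedDerivWithin,
      iteratedDerivWithin_of_isOpen hU ht, tower hU F h i t ht]
    exact hD i h1 h2

/-- The tower of derivatives of the log density. -/
noncomputable def towerF {d : ℕ} (c : ℝ) (s y : Fin d → ℝ) : ℕ → ℝ → ℝ
  | 0, t => c + ∑ i, (-(1/2) * Real.log (1 + t * s i) - (1/2) * y i ^ 2 * (1 + t * s i)⁻¹)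
  | n+1, t => ∑ i, (-(1/2) * ((-1)^n * n.factorial * s i ^ (n+1) * ((1 + t * s i)⁻¹)^(n+1))
      - (1/2) * y i ^ 2 * ((-1)^(n+1) * (n+1).factorial * s i ^ (n+1) * ((1 + t * s i)⁻¹)^(n+2)))

theorem towerF_deriv {d : ℕ} (c : ℝ) (s y : Fin d → ℝ) (n : ℕ) (t : ℝ)
    (ht : ∀ i, 0 < 1 + t * s i) : HasDerivAt (towerF c s y n) (towerF c s y (n+1) t) t := by
  have hl : ∀ i, HasDerivAt (fun u => 1 + u * s i) (s i) t := fun i => by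
    simpa using ((hasDerivAt_id t).mul_const (s i)).const_add 1
  have hi : ∀ i, HasDerivAt (fun u => (1 + u * s i)⁻¹) (-s i / (1 + t * s i)^2) t := fun i =>
    (hl i).inv (ht i).ne'
  cases n with
  | zero =>
    have : HasDerivAt (fun u => c + ∑ i, (-(1/2) * Real.log (1 + u * s i)
        - (1/2) * y i ^ 2 * (1 + u * s i)⁻¹))
        (∑ i, (-(1/2) * (s i / (1 + t * s i)) - (1/2) * y i ^ 2 * (-s i / (1 + t * s i)^2))) t := by
      apply HasDerivAt.const_add
      apply HasDerivAt.fun_sum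
      intro i _
      exact (((hl i).log (ht i).ne').const_mul _).sub ((hi i).const_mul _)
    refine this.congr_deriv ?_
    simp only [towerF]
    refine Finset.sum_congr rfl fun i _ => ?_
    have := (ht i).ne'
    simp
    field_simp
    ring
  | succ n =>
    have : HasDerivAt (fun u => ∑ i, (-(1/2) * ((-1)^n * n.factorial * s i ^ (n+1) *
        ((1 + u * s i)⁻¹)^(n+1)) - (1/2) * y i ^ 2 * ((-1)^(n+1) * (n+1).factorial *
        s i ^ (n+1) * ((1 + u * s i)⁻¹)^(n+2))))
        (∑ i, (-(1/2) * ((-1)^n * n.factorial * s i ^ (n+1) *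
          (((n+1 : ℕ) : ℝ) * ((1 + t * s i)⁻¹)^(n+1-1) * (-s i / (1 + t * s i)^2)))
          - (1/2) * y i ^ 2 * ((-1)^(n+1) * (n+1).factorial * s i ^ (n+1) *
          (((n+2 : ℕ) : ℝ) * ((1 + t * s i)⁻¹)^(n+2-1) * (-s i / (1 + t * s i)^2))))) t := by
      apply HasDerivAt.fun_sum
      intro i _
      exact ((((hi i).fun_pow (n+1)).const_mul _).const_mul _).sub
        ((((hi i).fun_pow (n+2)).const_mul _).const_mul _)
    refine this.congr_deriv ?_
    simp only [towerF]
    refine Finset.sum_congr rfl fun i _ => ?_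
    have := (ht i).ne'
    simp only [Nat.factorial_succ, div_eq_mul_inv, ← inv_pow]
    push_cast
    ring

theorem towerF_bound {d : ℕ} (hd : 1 ≤ d) (c : ℝ) (s y : Fin d → ℝ) (t S Y : ℝ) (hY : 0 ≤ Y)
    (ht : ∀ i, 1 / 2 ≤ 1 + t * s i) (hS : ∀ i, |s i| ≤ S) (hy : ∀ i, y i ^ 2 ≤ Y)
    (k i : ℕ) (h1 : 1 ≤ i) (hk : i ≤ k) :
    |towerF c s y i t| ≤ (d * k.factorial * (1 + Y) * (2 * S)) ^ i := by
  obtain ⟨n, rfl⟩ : ∃ n, i = n + 1 := ⟨i - 1, by omega⟩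
  have hS0 : 0 ≤ S := (abs_nonneg _).trans (hS ⟨0, hd⟩)
  have hkf : (1:ℝ) ≤ k.factorial := by exact_mod_cast Nat.succ_le_of_lt (Nat.factorial_pos k)
  have hd' : (1:ℝ) ≤ d := by exact_mod_cast hd
  have hf1 : ((n+1).factorial : ℝ) ≤ k.factorial := by exact_mod_cast Nat.factorial_le hk
  have hf0 : (n.factorial : ℝ) ≤ k.factorial := by
    exact_mod_cast Nat.factorial_le (by omega : n ≤ k)
  have hterm : ∀ j, |(-(1/2) * ((-1)^n * n.factorial * s j ^ (n+1) * ((1 + t * s j)⁻¹)^(n+1))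
      - (1/2) * y j ^ 2 * ((-1)^(n+1) * (n+1).factorial * s j ^ (n+1) *
        ((1 + t * s j)⁻¹)^(n+2)))| ≤ k.factorial * (1 + Y) * (2 * S) ^ (n+1) := by
    intro j
    have hw0 : 0 < (1 + t * s j)⁻¹ := inv_pos.2 (by linarith [ht j])
    have hw : (1 + t * s j)⁻¹ ≤ 2 := by
      rw [inv_le_comm₀ (by linarith [ht j]) (by norm_num)]; linarith [ht j]
    set w := (1 + t * s j)⁻¹
    have e1 : |s j| ^ (n+1) * w ^ (n+1) ≤ (2 * S) ^ (n+1) := by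
      rw [← mul_pow]
      apply pow_le_pow_left₀ (by positivity)
      rw [mul_comm]
      exact mul_le_mul hw (hS j) (abs_nonneg _) (by norm_num)
    set q := |s j| ^ (n+1) * w ^ (n+1) with hq
    have hq0 : 0 ≤ q := by positivity
    have hyj := sq_nonneg (y j)
    have a1 : |-(1/2) * ((-1)^n * n.factorial * s j ^ (n+1) * w^(n+1))| =
        1/2 * (n.factorial * q) := by
      simp only [abs_mul, abs_neg, abs_pow, abs_one, one_pow, Nat.abs_cast, abs_of_pos hw0, hq]
      norm_num; ring
    have a2 : |(1/2) * y j ^ 2 * ((-1)^(n+1) * (n+1).factorial * s j ^ (n+1) * w^(n+2))| =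
        1/2 * w * (y j ^ 2 * ((n+1).factorial * q)) := by
      simp only [abs_mul, abs_neg, abs_pow, abs_one, one_pow, Nat.abs_cast, abs_of_pos hw0, hq,
        sq_abs]
      norm_num; ring
    have b1 : (n.factorial : ℝ) * q ≤ k.factorial * (2 * S) ^ (n+1) :=
      mul_le_mul hf0 e1 hq0 (by positivity)
    have b2 : ((n+1).factorial : ℝ) * q ≤ k.factorial * (2 * S) ^ (n+1) :=
      mul_le_mul hf1 e1 hq0 (by positivity)
    have b3 : y j ^ 2 * ((n+1).factorial * q) ≤ Y * (k.factorial * (2 * S) ^ (n+1)) :=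
      mul_le_mul (hy j) b2 (by positivity) hY
    have b4 : 1/2 * w * (y j ^ 2 * ((n+1).factorial * q)) ≤
        1 * (Y * (k.factorial * (2 * S) ^ (n+1))) :=
      mul_le_mul (by linarith) b3 (by positivity) (by norm_num)
    have b5 : 0 ≤ (n.factorial : ℝ) * q := by positivity
    refine (abs_sub _ _).trans ?_
    rw [a1, a2]
    nlinarith
  have hsum : |towerF c s y (n+1) t| ≤ d * (k.factorial * (1 + Y) * (2 * S) ^ (n+1)) := by
    simp only [towerF]
    refine (Finset.abs_sum_le_sum_abs _ _).trans ?_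
    refine (Finset.sum_le_sum fun j _ => hterm j).trans ?_
    simp
  refine hsum.trans ?_
  rw [mul_pow _ (2 * S), ← mul_assoc, ← mul_assoc]
  apply mul_le_mul_of_nonneg_right _ (by positivity)
  apply le_self_pow₀ _ (by omega)
  have : 1 ≤ (d:ℝ) * k.factorial := one_le_mul_of_one_le_of_one_le hd' hkf
  exact one_le_mul_of_one_le_of_one_le this (by linarith)

theorem gauss_eq {d : ℕ} (A K P : Matrix (Fin d) (Fin d) ℝ) (s : Fin d → ℝ)
    (hP : Pᵀ * K * P = 1) (hs : Pᵀ * (A - K) * P = diagonal s) (x : Fin d → ℝ) (t : ℝ)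
    (ht : ∀ i, 0 < 1 + t * s i) :
    gaussDensity (Gam A K t) x = Real.exp (towerF (-(1/2) * Real.log ((2 * Real.pi) ^ d *
      (P.det ^ 2)⁻¹)) s (Pᵀ *ᵥ x) 0 t) := by
  have hG : Pᵀ * Gam A K t * P = diagonal (fun i => 1 + t * s i) := by
    have : Gam A K t = K + t • (A - K) := by
      simp only [Gam, smul_sub, sub_smul, one_smul]; abel
    rw [this, mul_add, add_mul, hP, mul_smul_comm, smul_mul_assoc, hs, ← diagonal_one,
      ← diagonal_smul, diagonal_add]
    rfl
  have hPd : P.det ≠ 0 := by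
    intro h
    have := congrArg det hP
    simp [h] at this
  have hdet : (Gam A K t).det = (P.det ^ 2)⁻¹ * ∏ i, (1 + t * s i) := by
    have := congrArg det hG
    rw [det_mul, det_mul, det_transpose, det_diagonal] at this
    rw [← this]; field_simp
  have hinv : (Gam A K t)⁻¹ = P * diagonal (fun i => (1 + t * s i)⁻¹) * Pᵀ := by
    apply inv_eq_left_inv
    have h1 : (diagonal (fun i => (1 + t * s i)⁻¹) * Pᵀ * Gam A K t) * P = 1 := by
      rw [Matrix.mul_assoc, Matrix.mul_assoc, ← Matrix.mul_assoc Pᵀ, hG, diagonal_mul_diagonal,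
        ← diagonal_one]
      congr 1
      ext i
      exact inv_mul_cancel₀ (ht i).ne'
    have h2 := mul_eq_one_comm.1 h1
    rw [← h2]; simp only [Matrix.mul_assoc]
  have hquad : x ⬝ᵥ (Gam A K t)⁻¹ *ᵥ x = ∑ i, (Pᵀ *ᵥ x) i ^ 2 * (1 + t * s i)⁻¹ := by
    rw [hinv, ← mulVec_mulVec, ← mulVec_mulVec, dotProduct_mulVec, ← mulVec_transpose]
    simp only [dotProduct, mulVec_diagonal]
    exact Finset.sum_congr rfl fun i _ => by ring
  have hprod : 0 < ∏ i, (1 + t * s i) := Finset.prod_pos fun i _ => ht i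
  have hc : 0 < (2 * Real.pi) ^ d * (P.det ^ 2)⁻¹ := by positivity
  rw [gaussDensity, hdet, hquad, ← mul_assoc]
  have hsq : (Real.sqrt ((2 * Real.pi) ^ d * (P.det ^ 2)⁻¹ * ∏ i, (1 + t * s i)))⁻¹ =
      Real.exp (-(1/2) * (Real.log ((2 * Real.pi) ^ d * (P.det ^ 2)⁻¹) +
        ∑ i, Real.log (1 + t * s i))) := by
    rw [← Real.log_prod (fun i _ => (ht i).ne'), ← Real.log_mul hc.ne' hprod.ne',
      Real.sqrt_eq_rpow, ← Real.rpow_neg (by positivity), Real.rpow_def_of_pos (by positivity)]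
    congr 1; ring
  rw [hsq, ← Real.exp_add]
  congr 1
  simp only [towerF, Finset.sum_sub_distrib, ← Finset.mul_sum, mul_assoc]
  ring

end Helpers

/-- Lemma `pol_bound_hk`: polynomial bound for `h_k` on the event `E`. -/
theorem statement_6
    {d : ℕ} (hd : 1 ≤ d)
    (K : Matrix (Fin d) (Fin d) ℝ) (hK : K.PosDef)
    (k : ℕ) (hk : 1 ≤ k) :
    ∃ p : Polynomial ℝ, (∀ y : ℝ, 0 < p.eval y) ∧
      ∀ A : Matrix (Fin d) (Fin d) ℝ, A.PosSemidef →
        opNorm (A - K) ≤ lambdaMin K / 2 →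
        ∀ t ∈ Set.Icc (0 : ℝ) 1, ∀ x : Fin d → ℝ,
          |hfun k A K t x| ≤ p.eval (euclNorm x) * hsNorm (A - K) ^ k := by
  have hl := lambda_pos hd K hK
  set l := lambdaMin K with hldef
  refine ⟨Polynomial.C (k.factorial * (d * k.factorial * (2 / l)) ^ k) *
    (1 + Polynomial.C (l⁻¹) * Polynomial.X ^ 2) ^ k, ?_, ?_⟩
  · intro y
    have : (0:ℝ) < d := by exact_mod_cast hd
    simp only [Polynomial.eval_mul, Polynomial.eval_C, Polynomial.eval_pow, Polynomial.eval_add,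
      Polynomial.eval_one, Polynomial.eval_X]
    positivity
  intro A hA hop t ht x
  have hB : (A - K).IsHermitian := hA.1.sub hK.1
  obtain ⟨P, s, hP, hs⟩ := aux_diag K (A - K) hK hB
  -- columns
  have hent : ∀ (M : Matrix (Fin d) (Fin d) ℝ) i,
      (Pᵀ * M * P) i i = (Pᵀ i) ⬝ᵥ (M *ᵥ (Pᵀ i)) := by
    intro M i
    rw [Matrix.mul_assoc, Matrix.mul_apply']
    rfl
  have hK1 : ∀ i, (Pᵀ i) ⬝ᵥ (K *ᵥ (Pᵀ i)) = 1 := fun i => by rw [← hent, hP]; simp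
  have hBs : ∀ i, (Pᵀ i) ⬝ᵥ ((A - K) *ᵥ (Pᵀ i)) = s i := fun i => by rw [← hent, hs]; simp
  have hne : ∀ i, Pᵀ i ≠ 0 := fun i h => by
    have := hK1 i
    rw [h] at this; simp at this
  have hnorm : ∀ i, euclNorm (Pᵀ i) ^ 2 ≤ l⁻¹ := fun i => by
    have := lambda_le K hK (hne i)
    rw [hK1 i] at this
    rw [← one_div, le_div_iff₀ hl]; linarith
  have hsop : ∀ i, |s i| ≤ 1 / 2 := fun i => by
    rw [← hBs i]
    have h1 := abs_dot_le (Pᵀ i) ((A - K) *ᵥ (Pᵀ i))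
    have h2 := mulVec_le_op (A - K) (hne i)
    have h3 := euclNorm_nonneg' (Pᵀ i)
    have h4 : euclNorm (Pᵀ i) * euclNorm ((A - K) *ᵥ (Pᵀ i)) ≤
        euclNorm (Pᵀ i) ^ 2 * (l / 2) := by
      have := mul_le_mul_of_nonneg_left
        (h2.trans (mul_le_mul_of_nonneg_right hop h3)) h3
      linarith
    have h5 := mul_le_mul_of_nonneg_right (hnorm i) (by positivity : 0 ≤ l / 2)
    have h6 : l⁻¹ * (l / 2) = 1 / 2 := by field_simp
    linarith
  have hshs : ∀ i, |s i| ≤ hsNorm (A - K) / l := fun i => by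
    rw [← hBs i]
    have h1 := abs_dot_le (Pᵀ i) ((A - K) *ᵥ (Pᵀ i))
    have h2 := mulVec_le (A - K) (Pᵀ i)
    have h3 := euclNorm_nonneg' (Pᵀ i)
    have h0 : 0 ≤ hsNorm (A - K) := Real.sqrt_nonneg _
    have h4 := mul_le_mul_of_nonneg_left h2 h3
    have h5 := mul_le_mul_of_nonneg_right (hnorm i) h0
    rw [div_eq_inv_mul]
    linarith
  have hy : ∀ i, (Pᵀ *ᵥ x) i ^ 2 ≤ l⁻¹ * euclNorm x ^ 2 := fun i => by
    have h1 : |(Pᵀ *ᵥ x) i| ≤ _ := abs_dot_le (Pᵀ i) x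
    rw [← sq_abs]
    calc _ ≤ (euclNorm (Pᵀ i) * euclNorm x) ^ 2 := pow_le_pow_left₀ (abs_nonneg _) h1 2
      _ = euclNorm (Pᵀ i) ^ 2 * euclNorm x ^ 2 := mul_pow _ _ _
      _ ≤ _ := mul_le_mul_of_nonneg_right (hnorm i) (sq_nonneg _)
  set c := -(1/2) * Real.log ((2 * Real.pi) ^ d * (P.det ^ 2)⁻¹) with hc
  have hpos : ∀ u ∈ Set.Ioo (-1 : ℝ) (3/2), ∀ i, 0 < 1 + u * s i := by
    intro u hu i
    have := abs_le.1 (hsop i)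
    rcases le_total 0 (s i) with h | h
    · nlinarith [hu.1]
    · nlinarith [hu.2]
  have hhalf : ∀ i, 1 / 2 ≤ 1 + t * s i := by
    intro i
    have := abs_le.1 (hsop i)
    nlinarith [ht.1, ht.2]
  have htU : t ∈ Set.Ioo (-1 : ℝ) (3/2) := ⟨by linarith [ht.1], by linarith [ht.2]⟩
  set z := Pᵀ *ᵥ x with hz
  set c' := c - towerF c s z 0 0 with hc'
  have hg : ∀ u ∈ Set.Ioo (-1 : ℝ) (3/2), gfun A K u x = Real.exp (towerF c' s z 0 u) := by
    intro u hu
    have h0 := gauss_eq A K P s hP hs x 0 (by simp)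
    have h1 := gauss_eq A K P s hP hs x u (hpos u hu)
    have hK0 : Gam A K 0 = K := by simp [Gam]
    rw [hK0] at h0
    rw [gfun, h0, h1, ← Real.exp_sub]
    congr 1
    rw [hc']
    simp only [towerF]
    ring
  have hev : (fun u => gfun A K u x) =ᶠ[nhds t] fun u => Real.exp (towerF c' s z 0 u) :=
    Filter.eventually_of_mem (isOpen_Ioo.mem_nhds htU) hg
  have key := tower_exp isOpen_Ioo (towerF c' s z)
    (fun n u hu => towerF_deriv c' s z n u (hpos u hu)) k t htU
    (d * k.factorial * (1 + l⁻¹ * euclNorm x ^ 2) * (2 * (hsNorm (A - K) / l)))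
    (fun i h1 h2 => towerF_bound hd c' s z t _ _ (by positivity) hhalf hshs hy k i h1 h2)
  rw [hfun, hev.iteratedDeriv_eq, hg t htU, abs_div, Real.abs_exp, div_le_iff₀ (Real.exp_pos _)]
  refine key.trans (le_of_eq ?_)
  simp only [Polynomial.eval_mul, Polynomial.eval_C, Polynomial.eval_pow, Polynomial.eval_add,
      Polynomial.eval_one, Polynomial.eval_X]
  simp only [mul_pow, div_eq_mul_inv]
  ring
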